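/- (Combinatorial form of the main theorem, horospherical case.) Suppose L(id) = 0, where id(t) = t; since L is linear in g and vanishes on constants, this means L vanishes on all affine functions, i.e., the Futaki invariant vanishes. Then there exists ε > 0 such that for every convex continuous function g : [s₋, s₊] → ℝ one has L(g) ≥ ε·inf_{λ ∈ ℝ} J(t ↦ g(t) + λ·t). -/

import Mathlib

open MeasureTheory

/-- The functional `k ↦ k(lo) A + k(hi) B - ∫ 2 k f` on functions on `[lo, hi]`. -/
noncomputable def boundaryFunctional (lo hi A B : ℝ) (f k : ℝ → ℝ) : ℝ :=
  k lo * A + k hi * B - ∫ t in lo..hi, 2 * k t * f t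

section BoundaryFunctional

variable {lo hi A B : ℝ} {f : ℝ → ℝ}

lemma boundaryFunctional_linear_combination (h : lo ≤ hi) (hf : Continuous f) {k₁ k₂ : ℝ → ℝ}
    (hk₁ : ContinuousOn k₁ (Set.Icc lo hi)) (hk₂ : ContinuousOn k₂ (Set.Icc lo hi)) (x y : ℝ) :
    boundaryFunctional lo hi A B f (fun t => x * k₁ t + y * k₂ t) =
      x * boundaryFunctional lo hi A B f k₁ + y * boundaryFunctional lo hi A B f k₂ := by
  have key {k : ℝ → ℝ} (hk : ContinuousOn k (Set.Icc lo hi)) (z : ℝ) :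
      IntervalIntegrable (fun t => z * (2 * k t * f t)) volume lo hi :=
    ContinuousOn.intervalIntegrable_of_Icc h (by fun_prop)
  have hint : ∫ t in lo..hi, 2 * (x * k₁ t + y * k₂ t) * f t =
      x * (∫ t in lo..hi, 2 * k₁ t * f t) + y * ∫ t in lo..hi, 2 * k₂ t * f t := by
    rw [← intervalIntegral.integral_const_mul, ← intervalIntegral.integral_const_mul,
      ← intervalIntegral.integral_add (key hk₁ x) (key hk₂ y)]
    exact intervalIntegral.integral_congr fun t _ => by ring
  unfold boundaryFunctional
  rw [hint]
  ring

lemma boundaryFunctional_add_weight (h : lo ≤ hi) (hf : Continuous f) {P k : ℝ → ℝ}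
    (hP : Continuous P) (hk : ContinuousOn k (Set.Icc lo hi)) (s : ℝ) :
    boundaryFunctional lo hi A B (fun t => f t + s * P t) k =
      boundaryFunctional lo hi A B f k - 2 * s * ∫ t in lo..hi, k t * P t := by
  have h₁ : IntervalIntegrable (fun t => 2 * k t * f t) volume lo hi :=
    ContinuousOn.intervalIntegrable_of_Icc h (by fun_prop)
  have h₂ : IntervalIntegrable (fun t => 2 * s * (k t * P t)) volume lo hi :=
    ContinuousOn.intervalIntegrable_of_Icc h (by fun_prop)
  have hint : ∫ t in lo..hi, 2 * k t * (f t + s * P t) =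
      (∫ t in lo..hi, 2 * k t * f t) + 2 * s * ∫ t in lo..hi, k t * P t := by
    rw [← intervalIntegral.integral_const_mul, ← intervalIntegral.integral_add h₁ h₂]
    exact intervalIntegral.integral_congr fun t _ => by ring
  unfold boundaryFunctional
  rw [hint]
  ring

lemma mul_nonpos_on_Icc_of_Ioo (h : lo < hi) {k : ℝ → ℝ} (hf : Continuous f)
    (hk : ContinuousOn k (Set.Icc lo hi)) (hkf : ∀ t ∈ Set.Ioo lo hi, k t * f t ≤ 0) :
    ∀ t ∈ Set.Icc lo hi, k t * f t ≤ 0 := by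
  rw [← closure_Ioo h.ne] at hk ⊢
  exact fun t ht => le_on_closure (g := fun _ => (0 : ℝ)) hkf (by fun_prop) (by fun_prop) ht

lemma boundaryFunctional_nonneg (h : lo < hi) (hA : 0 ≤ A) (hB : 0 ≤ B) (hf : Continuous f)
    {k : ℝ → ℝ} (hk : ContinuousOn k (Set.Icc lo hi)) (hlo : 0 ≤ k lo) (hhi : 0 ≤ k hi)
    (hkf : ∀ t ∈ Set.Ioo lo hi, k t * f t ≤ 0) :
    0 ≤ boundaryFunctional lo hi A B f k := by
  have hint : 0 ≤ ∫ t in lo..hi, -(2 * k t * f t) :=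
    intervalIntegral.integral_nonneg h.le fun t ht => by
      linarith [mul_nonpos_on_Icc_of_Ioo h hf hk hkf t ht]
  rw [intervalIntegral.integral_neg] at hint
  unfold boundaryFunctional
  have := mul_nonneg hlo hA
  have := mul_nonneg hhi hB
  linarith

lemma boundaryFunctional_pos (h : lo < hi) (hA : 0 ≤ A) (hB : 0 ≤ B) (hf : Continuous f)
    {k : ℝ → ℝ} (hk : ContinuousOn k (Set.Icc lo hi)) (hlo : 0 ≤ k lo) (hhi : 0 ≤ k hi)
    (hkf : ∀ t ∈ Set.Ioo lo hi, k t * f t ≤ 0) (hlt : ∃ t ∈ Set.Icc lo hi, k t * f t < 0) :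
    0 < boundaryFunctional lo hi A B f k := by
  obtain ⟨s, hs, hs'⟩ := hlt
  have hint : 0 < ∫ t in lo..hi, -(2 * k t * f t) :=
    intervalIntegral.integral_pos h (by fun_prop)
      (fun t ht => by
        linarith [mul_nonpos_on_Icc_of_Ioo h hf hk hkf t (Set.Ioc_subset_Icc_self ht)])
      ⟨s, hs, by linarith⟩
  rw [intervalIntegral.integral_neg] at hint
  unfold boundaryFunctional
  have := mul_nonneg hlo hA
  have := mul_nonneg hhi hB
  linarith

/-- A continuous function which is positive at `s₀` and whose nonnegativity set is an interval
changes sign exactly at two points `p < s₀ < q`. -/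
lemma exists_sign_change_of_ordConnected (hf : Continuous f)
    (hS : {t ∈ Set.Ioo lo hi | 0 ≤ f t}.OrdConnected) {s₀ : ℝ} (hs₀ : s₀ ∈ Set.Ioo lo hi)
    (hfs : 0 < f s₀) :
    ∃ p q, lo ≤ p ∧ p < s₀ ∧ s₀ < q ∧ q ≤ hi ∧ ∀ t ∈ Set.Ioo lo hi,
      (p ≤ t ∧ t ≤ q ∧ 0 ≤ f t) ∨ (f t ≤ 0 ∧ (t ≤ p ∨ q ≤ t)) := by
  set S := {t ∈ Set.Ioo lo hi | 0 ≤ f t}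
  have hnhds : S ∈ nhds s₀ := by
    filter_upwards [Ioo_mem_nhds hs₀.1 hs₀.2, hf.continuousAt.eventually (lt_mem_nhds hfs)]
      with t ht ht' using ⟨ht, ht'.le⟩
  obtain ⟨x, y, hxy, hxyS⟩ := mem_nhds_iff_exists_Ioo_subset.1 hnhds
  have hbelow : BddBelow S := ⟨lo, fun t ht => ht.1.1.le⟩
  have habove : BddAbove S := ⟨hi, fun t ht => ht.1.2.le⟩
  have hne : S.Nonempty := ⟨s₀, hs₀, hfs.le⟩
  refine ⟨sInf S, sSup S, le_csInf hne fun t ht => ht.1.1.le, ?_, ?_,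
    csSup_le hne fun t ht => ht.1.2.le, fun t ht => ?_⟩
  · obtain ⟨z, hz⟩ := exists_between hxy.1
    exact (csInf_le hbelow (hxyS ⟨hz.1, hz.2.trans hxy.2⟩)).trans_lt hz.2
  · obtain ⟨z, hz⟩ := exists_between hxy.2
    exact hz.1.trans_le (le_csSup habove (hxyS ⟨hxy.1.trans hz.1, hz.2⟩))
  · by_cases htS : t ∈ S
    · exact Or.inl ⟨csInf_le hbelow htS, le_csSup habove htS, htS.2⟩
    · refine Or.inr ⟨(not_le.1 fun h => htS ⟨ht, h⟩).le, ?_⟩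
      by_contra! hcon
      obtain ⟨u, hu, hut⟩ := exists_lt_of_csInf_lt hne hcon.1
      obtain ⟨v, hv, htv⟩ := exists_lt_of_lt_csSup hne hcon.2
      exact htS (hS.out hu hv ⟨hut.le, htv.le⟩)

lemma ConvexOn.secant_le {s : Set ℝ} {g : ℝ → ℝ} (hg : ConvexOn ℝ s g) {x y z : ℝ}
    (hx : x ∈ s) (hz : z ∈ s) (hxy : x ≤ y) (hyz : y ≤ z) :
    (z - x) * g y ≤ (z - y) * g x + (y - x) * g z := by
  rcases hxy.eq_or_lt with rfl | hxy
  · simp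
  rcases hyz.eq_or_lt with rfl | hyz
  · simp
  exact hg.secant_mono_aux1 hx hz hxy hyz

lemma ConvexOn.exists_affine_le_of_mem_interior {s : Set ℝ} {g : ℝ → ℝ} (hg : ConvexOn ℝ s g)
    {x : ℝ} (hx : x ∈ interior s) : ∃ m, ∀ t ∈ s, g x + m * (t - x) ≤ g t := by
  have hxs := interior_subset hx
  refine ⟨derivWithin g (Set.Ioi x) x, fun t ht => ?_⟩
  rcases lt_trichotomy t x with h | rfl | h
  · have h₁ := (hg.slope_le_leftDeriv_of_mem_interior ht hx h).trans
      (hg.leftDeriv_le_rightDeriv_of_mem_interior hx)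
    rw [slope_def_field, div_le_iff₀ (by linarith)] at h₁
    linarith
  · simp
  · have h₁ := hg.rightDeriv_le_slope_of_mem_interior hx ht h
    rw [slope_def_field, le_div_iff₀ (by linarith)] at h₁
    linarith

lemma boundaryFunctional_max_sub_pos (h : lo < hi) (hA : 0 ≤ A) (hB : 0 ≤ B) (hf : Continuous f)
    (hS : {t ∈ Set.Ioo lo hi | 0 ≤ f t}.OrdConnected) {s₀ : ℝ} (hs₀ : s₀ ∈ Set.Ioo lo hi)
    (hfs : 0 < f s₀) (hone : boundaryFunctional lo hi A B f (fun _ => 1) = 0)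
    (hid : boundaryFunctional lo hi A B f (fun t => t) = 0) :
    0 < boundaryFunctional lo hi A B f (fun t => max (t - s₀) 0) := by
  obtain ⟨p, q, hp, hps, hsq, hq, hpq⟩ := exists_sign_change_of_ordConnected hf hS hs₀ hfs
  have hout (t : ℝ) (ht : t ≤ p ∨ q ≤ t) :
      0 ≤ (q - p) * max (t - s₀) 0 - (q - s₀) * (t - p) := by
    rcases ht with ht | ht
    · rw [max_eq_right (by linarith)]
      nlinarith
    · rw [max_eq_left (by linarith)]
      nlinarith
  have hpos : 0 < boundaryFunctional lo hi A B f
      (fun t => (q - p) * max (t - s₀) 0 - (q - s₀) * (t - p)) := by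
    refine boundaryFunctional_pos h hA hB hf (by fun_prop) (hout lo (.inl hp)) (hout hi (.inr hq))
      (fun t ht => ?_) ⟨s₀, Set.Ioo_subset_Icc_self hs₀, ?_⟩
    · rcases hpq t ht with ⟨h₁, h₂, h₃⟩ | ⟨h₁, h₂⟩
      · refine mul_nonpos_of_nonpos_of_nonneg ?_ h₃
        rcases le_total t s₀ with h₄ | h₄
        · rw [max_eq_right (by linarith)]
          nlinarith
        · rw [max_eq_left (by linarith)]
          nlinarith
      · exact mul_nonpos_of_nonneg_of_nonpos (hout t h₂) h₁
    · refine mul_neg_of_neg_of_pos ?_ hfs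
      simp only [sub_self, max_self]
      nlinarith
  have h₁ := boundaryFunctional_linear_combination (A := A) (B := B) h.le hf
    (k₁ := fun _ => 1) (k₂ := fun t => t) (by fun_prop) (by fun_prop) ((q - s₀) * p) (-(q - s₀))
  have h₂ := boundaryFunctional_linear_combination (A := A) (B := B) h.le hf
    (k₁ := fun t => max (t - s₀) 0) (k₂ := fun t => (q - s₀) * p * 1 + -(q - s₀) * t)
    (by fun_prop) (by fun_prop) (q - p) 1
  rw [h₁, hone, hid] at h₂
  have h₃ : (fun t => (q - p) * max (t - s₀) 0 - (q - s₀) * (t - p)) =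
      fun t => (q - p) * max (t - s₀) 0 + 1 * ((q - s₀) * p * 1 + -(q - s₀) * t) := by
    ext t
    ring
  rw [h₃, h₂] at hpos
  simp only [mul_zero, add_zero] at hpos
  exact pos_of_mul_pos_right hpos (by linarith)

/-- If the functional is nonnegative on both one-sided hinges at `s₀`, then it is nonnegative on
every nonnegative convex function vanishing at `s₀`. -/
lemma boundaryFunctional_nonneg_of_convexOn (h : lo < hi) (hA : 0 ≤ A) (hB : 0 ≤ B)
    (hf : Continuous f)
    (hS : {t ∈ Set.Ioo lo hi | 0 ≤ f t}.OrdConnected) {s₀ : ℝ} (hs₀ : s₀ ∈ Set.Ioo lo hi)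
    (hfs : 0 < f s₀)
    (hr : 0 ≤ boundaryFunctional lo hi A B f (fun t => max (t - s₀) 0))
    (hl : 0 ≤ boundaryFunctional lo hi A B f (fun t => max (s₀ - t) 0))
    {k : ℝ → ℝ} (hk : ContinuousOn k (Set.Icc lo hi)) (hconv : ConvexOn ℝ (Set.Icc lo hi) k)
    (hnonneg : ∀ t ∈ Set.Icc lo hi, 0 ≤ k t) (hzero : k s₀ = 0) :
    0 ≤ boundaryFunctional lo hi A B f k := by
  obtain ⟨p, q, hp, hps, hsq, hq, hpq⟩ := exists_sign_change_of_ordConnected hf hS hs₀ hfs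
  have hs₀' := Set.Ioo_subset_Icc_self hs₀
  have hpI : p ∈ Set.Icc lo hi := ⟨hp, by linarith⟩
  have hqI : q ∈ Set.Icc lo hi := ⟨by linarith, hq⟩
  set α := k q / (q - s₀)
  set β := k p / (s₀ - p)
  have hαq : α * (q - s₀) = k q := div_mul_cancel₀ _ (by linarith)
  have hβp : β * (s₀ - p) = k p := div_mul_cancel₀ _ (by linarith)
  have hα₀ : 0 ≤ α := div_nonneg (hnonneg q hqI) (by linarith)
  have hβ₀ : 0 ≤ β := div_nonneg (hnonneg p hpI) (by linarith)
  set m : ℝ → ℝ := fun t => α * max (t - s₀) 0 + β * max (s₀ - t) 0 with hm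
  have hmright (t : ℝ) (ht : s₀ ≤ t) : m t = α * (t - s₀) := by
    simp [hm, max_eq_left (sub_nonneg.2 ht), max_eq_right (sub_nonpos.2 ht)]
  have hmleft (t : ℝ) (ht : t ≤ s₀) : m t = β * (s₀ - t) := by
    simp [hm, max_eq_left (sub_nonneg.2 ht), max_eq_right (sub_nonpos.2 ht)]
  have hmc : Continuous m := by fun_prop
  have hout (t : ℝ) (htI : t ∈ Set.Icc lo hi) (ht : t ≤ p ∨ q ≤ t) : 0 ≤ k t - m t := by
    rcases ht with ht | ht
    · have := hconv.secant_le htI hs₀' ht hps.le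
      rw [hzero, ← hβp] at this
      rw [hmleft t (by linarith)]
      refine sub_nonneg.2 (le_of_mul_le_mul_left (a := s₀ - p) ?_ (by linarith))
      linarith
    · have := hconv.secant_le hs₀' htI hsq.le ht
      rw [hzero, ← hαq] at this
      rw [hmright t (by linarith)]
      refine sub_nonneg.2 (le_of_mul_le_mul_left (a := q - s₀) ?_ (by linarith))
      linarith
  have hdiff : 0 ≤ boundaryFunctional lo hi A B f (fun t => 1 * k t + (-1) * m t) := by
    refine boundaryFunctional_nonneg h hA hB hf (by fun_prop) ?_ ?_ fun t ht => ?_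
    · linarith [hout lo ⟨le_rfl, h.le⟩ (.inl hp)]
    · linarith [hout hi ⟨h.le, le_rfl⟩ (.inr hq)]
    have htI := Set.Ioo_subset_Icc_self ht
    rcases hpq t ht with ⟨h₁, h₂, h₃⟩ | ⟨h₁, h₂⟩
    · refine mul_nonpos_of_nonpos_of_nonneg ?_ h₃
      suffices k t ≤ m t by linarith
      rcases le_total t s₀ with h₄ | h₄
      · have := hconv.secant_le hpI hs₀' h₁ h₄
        rw [hzero, ← hβp] at this
        rw [hmleft t h₄]
        refine le_of_mul_le_mul_left (a := s₀ - p) ?_ (by linarith)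
        linarith
      · have := hconv.secant_le hs₀' hqI h₄ h₂
        rw [hzero, ← hαq] at this
        rw [hmright t h₄]
        refine le_of_mul_le_mul_left (a := q - s₀) ?_ (by linarith)
        linarith
    · exact mul_nonpos_of_nonneg_of_nonpos (by linarith [hout t htI h₂]) h₁
  rw [boundaryFunctional_linear_combination h.le hf hk hmc.continuousOn,
    boundaryFunctional_linear_combination h.le hf (by fun_prop) (by fun_prop)] at hdiff
  linarith [mul_nonneg hα₀ hr, mul_nonneg hβ₀ hl]

/-- Uniform lower bound for the functional in terms of the weighted integral of a convex function
minus a supporting affine function. -/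
lemma exists_boundaryFunctional_ge (h : lo < hi) (hA : 0 ≤ A) (hB : 0 ≤ B) (hf : Continuous f)
    {P : ℝ → ℝ} (hP : Continuous P) (hP₀ : ∀ t ∈ Set.Icc lo hi, 0 ≤ P t)
    (hS : ∀ s, {t ∈ Set.Ioo lo hi | 0 ≤ f t + s * P t}.OrdConnected)
    {s₀ : ℝ} (hs₀ : s₀ ∈ Set.Ioo lo hi) (hfs : 0 < f s₀)
    (hone : boundaryFunctional lo hi A B f (fun _ => 1) = 0)
    (hid : boundaryFunctional lo hi A B f (fun t => t) = 0) :
    ∃ ε > 0, ∀ g : ℝ → ℝ, ContinuousOn g (Set.Icc lo hi) → ConvexOn ℝ (Set.Icc lo hi) g →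
      ∃ m, (∀ t ∈ Set.Icc lo hi, g s₀ + m * (t - s₀) ≤ g t) ∧
        ε * (∫ t in lo..hi, (g t - (g s₀ + m * (t - s₀))) * P t) ≤
          boundaryFunctional lo hi A B f g := by
  have hS₀ := hS 0
  simp only [zero_mul, add_zero] at hS₀
  have hR := boundaryFunctional_max_sub_pos h hA hB hf hS₀ hs₀ hfs hone hid
  have haff (x y : ℝ) : boundaryFunctional lo hi A B f (fun t => x * 1 + y * t) = 0 := by
    have := boundaryFunctional_linear_combination (A := A) (B := B) h.le hf
      (k₁ := fun _ => 1) (k₂ := fun t => t) (by fun_prop) (by fun_prop) x y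
    rwa [hone, hid, mul_zero, mul_zero, add_zero] at this
  have hL : boundaryFunctional lo hi A B f (fun t => max (s₀ - t) 0) =
      boundaryFunctional lo hi A B f (fun t => max (t - s₀) 0) := by
    have h₁ := boundaryFunctional_linear_combination (A := A) (B := B) h.le hf
      (k₁ := fun t => max (t - s₀) 0) (k₂ := fun t => s₀ * 1 + (-1) * t)
      (by fun_prop) (by fun_prop) 1 1
    rw [haff, mul_zero, add_zero, one_mul] at h₁
    rw [← h₁]
    congr 1
    ext t
    rcases le_total t s₀ with h₂ | h₂
    · rw [max_eq_left (by linarith), max_eq_right (by linarith)]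
      ring
    · rw [max_eq_right (by linarith), max_eq_left (by linarith)]
      ring
  set K := boundaryFunctional lo hi A B f (fun t => max (t - s₀) 0)
  set I₁ := ∫ t in lo..hi, max (t - s₀) 0 * P t with hI₁def
  set I₂ := ∫ t in lo..hi, max (s₀ - t) 0 * P t with hI₂def
  have hI₁ : 0 ≤ I₁ := intervalIntegral.integral_nonneg h.le
    fun t ht => mul_nonneg (le_max_right _ _) (hP₀ t ht)
  have hI₂ : 0 ≤ I₂ := intervalIntegral.integral_nonneg h.le
    fun t ht => mul_nonneg (le_max_right _ _) (hP₀ t ht)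
  set ε := K / (I₁ + I₂ + 1)
  have hε : 0 < ε := by positivity
  have hεK : ε * (I₁ + I₂ + 1) = K := div_mul_cancel₀ _ (by positivity)
  refine ⟨ε, hε, fun g hg hgc => ?_⟩
  obtain ⟨m, hm⟩ := hgc.exists_affine_le_of_mem_interior (by rwa [interior_Icc])
  refine ⟨m, hm, ?_⟩
  set k : ℝ → ℝ := fun t => g t - (g s₀ + m * (t - s₀)) with hkdef
  have hkc : ContinuousOn k (Set.Icc lo hi) := by fun_prop
  have hkconv : ConvexOn ℝ (Set.Icc lo hi) k := by
    refine ⟨hgc.1, fun x hx y hy a b ha hb hab => ?_⟩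
    have := hgc.2 hx hy ha hb hab
    simp only [smul_eq_mul, hkdef] at this ⊢
    obtain rfl : b = 1 - a := by linarith
    linarith
  have hfs' : 0 < f s₀ + ε / 2 * P s₀ := by
    have := hP₀ s₀ (Set.Ioo_subset_Icc_self hs₀)
    positivity
  have hmain := boundaryFunctional_nonneg_of_convexOn (f := fun t => f t + ε / 2 * P t) h hA hB
    (by fun_prop) (hS (ε / 2)) hs₀ hfs'
    (by
      rw [boundaryFunctional_add_weight h.le hf hP (by fun_prop), ← hI₁def]
      nlinarith)
    (by
      rw [boundaryFunctional_add_weight h.le hf hP (by fun_prop), ← hI₂def, hL]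
      nlinarith)
    hkc hkconv (fun t ht => sub_nonneg.2 (hm t ht)) (by simp [hkdef])
  rw [boundaryFunctional_add_weight h.le hf hP hkc] at hmain
  have hgk : boundaryFunctional lo hi A B f k = boundaryFunctional lo hi A B f g := by
    have h₁ := boundaryFunctional_linear_combination (A := A) (B := B) h.le hf
      (k₁ := g) (k₂ := fun t => (m * s₀ - g s₀) * 1 + (-m) * t) hg (by fun_prop) 1 1
    rw [haff, mul_zero, add_zero, one_mul] at h₁
    rw [← h₁]
    congr 1
    ext t
    simp only [hkdef]
    ring
  rw [hgk] at hmain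
  linarith

end BoundaryFunctional

lemma convexOn_sum_div_affine {ι : Type*} [Fintype ι] {s : Set ℝ} (hs : Convex ℝ s)
    {b c w : ι → ℝ} (hw : ∀ i, 0 ≤ w i) (hpos : ∀ i, ∀ t ∈ s, 0 < b i + c i * t) :
    ConvexOn ℝ s (fun t => ∑ i, w i / (b i + c i * t)) := by
  refine ⟨hs, fun x hx y hy u v hu hv huv => ?_⟩
  simp only [smul_eq_mul, Finset.mul_sum, ← Finset.sum_add_distrib]
  refine Finset.sum_le_sum fun i _ => ?_
  have hinv := (convexOn_zpow (𝕜 := ℝ) (-1)).2 (hpos i x hx) (hpos i y hy) hu hv huv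
  simp only [smul_eq_mul, zpow_neg_one] at hinv
  have harg : u * (b i + c i * x) + v * (b i + c i * y) = b i + c i * (u * x + v * y) := by
    linear_combination b i * huv
  rw [harg] at hinv
  simp only [div_eq_mul_inv]
  linarith [mul_le_mul_of_nonneg_left hinv (hw i)]


/-- Combinatorial form of the main theorem of Delcroix's paper, horospherical case:
if `L(id) = 0` (vanishing of the Futaki invariant), then there is `ε > 0` with
`L(g) ≥ ε·inf_{λ ∈ ℝ} J(g + λ·id)` for every convex continuous
`g : [s₋, s₊] → ℝ` (G-uniform K-stability). -/
theorem uniform_K_stability_horospherical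
    {ι : Type*} [Fintype ι] [DecidableEq ι] [Nonempty ι]
    (sLo sHi : ℝ) (hs : sLo < sHi)
    (b c w : ι → ℝ)
    (hw : ∀ i, 0 < w i)
    (hpos : ∀ i, ∀ t ∈ Set.Ioo sLo sHi, 0 < b i + c i * t)
    (P Q : ℝ → ℝ)
    (hP : ∀ t, P t = ∏ i, (b i + c i * t) / w i)
    (hQ : ∀ t, Q t = ∑ i, ∏ j ∈ Finset.univ.erase i, (b j + c j * t) / w j)
    (a : ℝ)
    (ha : a = (P sLo + P sHi + 2 * ∫ t in sLo..sHi, Q t) / (2 * ∫ t in sLo..sHi, P t))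
    (L J : (ℝ → ℝ) → ℝ)
    (hL : ∀ g, L g = g sLo * P sLo + g sHi * P sHi
      - ∫ t in sLo..sHi, 2 * g t * (a * P t - Q t))
    (hJ : ∀ g, J g = ∫ t in sLo..sHi, (g t - sInf (g '' Set.Icc sLo sHi)) * P t)
    (hstab : L (fun t => t) = 0) :
    ∃ ε > 0, ∀ g : ℝ → ℝ, ContinuousOn g (Set.Icc sLo sHi) →
      ConvexOn ℝ (Set.Icc sLo sHi) g →
        L g ≥ ε * ⨅ l : ℝ, J (fun t => g t + l * t) := by
  have hPc : Continuous P := by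
    rw [funext hP]
    fun_prop
  have hQc : Continuous Q := by
    rw [funext hQ]
    fun_prop
  have hPpos : ∀ t ∈ Set.Ioo sLo sHi, 0 < P t := fun t ht => by
    rw [hP]
    exact Finset.prod_pos fun i _ => div_pos (hpos i t ht) (hw i)
  have hP₀ : ∀ t ∈ Set.Icc sLo sHi, 0 ≤ P t := by
    rw [← closure_Ioo hs.ne]
    exact fun t ht => le_on_closure (f := fun _ => (0 : ℝ)) (fun t ht => (hPpos t ht).le)
      (by fun_prop) (by fun_prop) ht
  have hPlo := hP₀ sLo ⟨le_rfl, hs.le⟩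
  have hPhi := hP₀ sHi ⟨hs.le, le_rfl⟩
  have hPint : 0 < ∫ t in sLo..sHi, P t :=
    intervalIntegral.intervalIntegral_pos_of_pos_on (hPc.intervalIntegrable _ _) hPpos hs
  have hQP : ∀ t ∈ Set.Ioo sLo sHi, Q t = (∑ i, w i / (b i + c i * t)) * P t := fun t ht => by
    rw [hQ, hP, Finset.sum_mul]
    refine Finset.sum_congr rfl fun i _ => ?_
    rw [← Finset.mul_prod_erase _ _ (Finset.mem_univ i), ← mul_assoc,
      div_mul_div_cancel₀ (hpos i t ht).ne', div_self (hw i).ne', one_mul]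
  have hsign : ∀ r, ∀ t ∈ Set.Ioo sLo sHi,
      0 ≤ r * P t - Q t ↔ ∑ i, w i / (b i + c i * t) ≤ r := fun r t ht => by
    rw [hQP t ht, sub_nonneg, mul_le_mul_iff_left₀ (hPpos t ht)]
  have hconv := convexOn_sum_div_affine (convex_Ioo sLo sHi) (fun i => (hw i).le) hpos
  have hord : ∀ s, {t ∈ Set.Ioo sLo sHi | 0 ≤ (a * P t - Q t) + s * P t}.OrdConnected := by
    intro s
    have hset : {t ∈ Set.Ioo sLo sHi | 0 ≤ (a * P t - Q t) + s * P t} =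
        {t ∈ Set.Ioo sLo sHi | ∑ i, w i / (b i + c i * t) ≤ a + s} := by
      ext t
      refine and_congr_right fun ht => ?_
      rw [← hsign _ t ht]
      ring_nf
    exact hset ▸ (hconv.convex_le (a + s)).ordConnected
  have hfc : Continuous fun t => a * P t - Q t := by fun_prop
  have hint : 2 * ∫ t in sLo..sHi, (a * P t - Q t) = P sLo + P sHi := by
    rw [intervalIntegral.integral_sub ((hPc.const_mul a).intervalIntegrable _ _)
      (hQc.intervalIntegrable _ _), intervalIntegral.integral_const_mul, ha]
    field_simp
    ring
  have hex : ∃ s₀ ∈ Set.Ioo sLo sHi, 0 < a * P s₀ - Q s₀ := by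
    by_contra! hcon
    have hle : ∀ t ∈ Set.Icc sLo sHi, 1 * (a * P t - Q t) ≤ 0 :=
      mul_nonpos_on_Icc_of_Ioo hs hfc (k := fun _ => 1) (by fun_prop) (by simpa using hcon)
    have hzero : ∀ t ∈ Set.Icc sLo sHi, a * P t - Q t = 0 := by
      intro t ht
      by_contra hne
      have : 0 < ∫ t in sLo..sHi, -(a * P t - Q t) :=
        intervalIntegral.integral_pos hs (by fun_prop)
          (fun t ht => by linarith [hle t (Set.Ioc_subset_Icc_self ht)])
          ⟨t, ht, by linarith [lt_of_le_of_ne (by linarith [hle t ht]) hne]⟩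
      rw [intervalIntegral.integral_neg] at this
      linarith
    have hPlo₀ : P sLo = 0 := by
      rw [intervalIntegral.integral_congr (g := fun _ => (0 : ℝ))
        (fun t ht => hzero t (by rwa [Set.uIcc_of_le hs.le] at ht))] at hint
      simp at hint
      linarith
    obtain ⟨i, -, hi⟩ := Finset.prod_eq_zero_iff.1 ((hP sLo).symm.trans hPlo₀)
    have hi' : b i + c i * sLo = 0 := (div_eq_zero_iff.1 hi).resolve_right (hw i).ne'
    have hwle : ∀ t ∈ Set.Ioo sLo sHi, w i ≤ a * (b i + c i * t) := fun t ht => by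
      rw [← div_le_iff₀ (hpos i t ht)]
      refine le_trans ?_ ((hsign a t ht).1 (hzero t (Set.Ioo_subset_Icc_self ht)).ge)
      exact Finset.single_le_sum (f := fun j => w j / (b j + c j * t))
        (fun j _ => (div_pos (hw j) (hpos j t ht)).le) (Finset.mem_univ i)
    have hlim : w i ≤ a * (b i + c i * sLo) :=
      le_on_closure (f := fun _ => w i) hwle (by fun_prop) (by fun_prop)
        (by rw [closure_Ioo hs.ne]; exact ⟨le_rfl, hs.le⟩)
    rw [hi', mul_zero] at hlim
    exact (hw i).not_ge hlim
  obtain ⟨s₀, hs₀, hfs⟩ := hex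
  have hLb : ∀ g, L g = boundaryFunctional sLo sHi (P sLo) (P sHi) (fun t => a * P t - Q t) g := hL
  have hone : boundaryFunctional sLo sHi (P sLo) (P sHi) (fun t => a * P t - Q t)
      (fun _ => 1) = 0 := by
    simp only [boundaryFunctional, mul_one, one_mul, intervalIntegral.integral_const_mul]
    rw [hint, sub_self]
  obtain ⟨ε, hε, hbound⟩ := exists_boundaryFunctional_ge hs hPlo hPhi hfc hPc hP₀ hord hs₀ hfs
    hone ((hLb _).symm.trans hstab)
  refine ⟨ε, hε, fun g hg hgc => ?_⟩
  obtain ⟨m, hm, hle⟩ := hbound g hg hgc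
  rw [hLb, ge_iff_le]
  refine le_trans (mul_le_mul_of_nonneg_left ?_ hε.le) hle
  have hbdd : BddBelow (Set.range fun l : ℝ => J (fun t => g t + l * t)) := by
    refine ⟨0, ?_⟩
    rintro _ ⟨l, rfl⟩
    simp only [hJ]
    refine intervalIntegral.integral_nonneg hs.le fun t ht =>
      mul_nonneg (sub_nonneg.2 (csInf_le ?_ (Set.mem_image_of_mem _ ht))) (hP₀ t ht)
    exact (isCompact_Icc.image_of_continuousOn (by fun_prop)).bddBelow
  refine (ciInf_le hbdd (-m)).trans (le_of_eq ?_)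
  have hinf : sInf ((fun t => g t + -m * t) '' Set.Icc sLo sHi) = g s₀ + -m * s₀ := by
    refine IsLeast.csInf_eq ⟨Set.mem_image_of_mem _ (Set.Ioo_subset_Icc_self hs₀), ?_⟩
    rintro _ ⟨t, ht, rfl⟩
    linarith [hm t ht]
  rw [hJ, hinf]
  exact intervalIntegral.integral_congr fun t _ => by ring
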